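/- arXiv:2506.11409 — 5 statements merged into one kernel-verified Lean document; each statement's English description precedes it below -/
import Mathlib

section
/- Let F : ℝ^d → ℝ^d be ℓ-Lipschitz, let A : ℝ^d → ℝ^{mN} be a continuous linear map with operator norm at most a, let L : ℝ^{mN} → ℝ^{mN} be a continuous linear map with operator norm at most κ, and let b̄ ∈ ℝ^{mN}. Then the extended operator V on the product space ℝ^d × ℝ^{mN} × ℝ^{mN} (with the product inner-product norm) defined by V(u,p,y) = (F(u) + A*(y), L(y), b̄ + L(y − p) − A(u)) is Lipschitz continuous with Lipschitz constant ℓ + 2κ + a. -/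
open RealInnerProductSpace

/-- Sum-of-squares form of the triangle inequality for the three blocks of the extended operator,
in terms of bounds on the norms of the individual components. -/
lemma sq_add_sq_add_sq_le_of_block_bounds {ℓ a κ x q r X Y Z : ℝ}
    (hℓ : 0 ≤ ℓ) (ha : 0 ≤ a) (hκ : 0 ≤ κ)
    (hX₀ : 0 ≤ X) (hY₀ : 0 ≤ Y) (hZ₀ : 0 ≤ Z)
    (hX : X ≤ ℓ * x + a * r) (hY : Y ≤ κ * r) (hZ : Z ≤ κ * (r + q) + a * x) :
    X ^ 2 + Y ^ 2 + Z ^ 2 ≤ (ℓ + 2 * κ + a) ^ 2 * (x ^ 2 + q ^ 2 + r ^ 2) := by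
  have hX2 : X ^ 2 ≤ (ℓ * x + a * r) ^ 2 := by gcongr
  have hY2 : Y ^ 2 ≤ (κ * r) ^ 2 := by gcongr
  have hZ2 : Z ^ 2 ≤ (κ * (r + q) + a * x) ^ 2 := by gcongr
  have hℓℓ : 0 ≤ ℓ ^ 2 * (q ^ 2 + r ^ 2) := by positivity
  have haa : 0 ≤ a ^ 2 * q ^ 2 := by positivity
  have hκκ : 0 ≤ κ ^ 2 * (4 * x ^ 2 + 2 * q ^ 2 + r ^ 2 + (r - q) ^ 2) := by positivity
  have hℓκ : 0 ≤ ℓ * κ * (4 * (x ^ 2 + q ^ 2 + r ^ 2)) := by positivity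
  have hℓa : 0 ≤ ℓ * a * (x ^ 2 + r ^ 2 + 2 * q ^ 2 + (x - r) ^ 2) := by positivity
  have hκa : 0 ≤ κ * a * (2 * x ^ 2 + 3 * q ^ 2 + 3 * r ^ 2 + (x - r) ^ 2 + (x - q) ^ 2) := by
    positivity
  linarith

/-- The extended operator `V(u,p,y) = (F(u) + A*(y), L(y), b̄ + L(y − p) − A(u))`
of the distributed splitting scheme is `(ℓ + 2κ + a)`-Lipschitz on the product space
`ℝ^d × ℝ^{mN} × ℝ^{mN}` equipped with the Euclidean product norm
`‖(u,p,y)‖² = ‖u‖² + ‖p‖² + ‖y‖²`. -/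
theorem extended_operator_lipschitz {d mN : ℕ}
    (F : EuclideanSpace ℝ (Fin d) → EuclideanSpace ℝ (Fin d))
    (ℓ a κ : ℝ) (hℓ : 0 ≤ ℓ)
    (hF : ∀ u u', ‖F u - F u'‖ ≤ ℓ * ‖u - u'‖)
    (A : EuclideanSpace ℝ (Fin d) →L[ℝ] EuclideanSpace ℝ (Fin mN)) (hA : ‖A‖ ≤ a)
    (L : EuclideanSpace ℝ (Fin mN) →L[ℝ] EuclideanSpace ℝ (Fin mN)) (hL : ‖L‖ ≤ κ)
    (bbar : EuclideanSpace ℝ (Fin mN)) :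
    ∀ (u u' : EuclideanSpace ℝ (Fin d)) (p p' y y' : EuclideanSpace ℝ (Fin mN)),
      Real.sqrt (‖(F u + ContinuousLinearMap.adjoint A y)
            - (F u' + ContinuousLinearMap.adjoint A y')‖ ^ 2
          + ‖L y - L y'‖ ^ 2
          + ‖(bbar + L (y - p) - A u) - (bbar + L (y' - p') - A u')‖ ^ 2)
        ≤ (ℓ + 2 * κ + a) *
          Real.sqrt (‖u - u'‖ ^ 2 + ‖p - p'‖ ^ 2 + ‖y - y'‖ ^ 2) := by
  intro u u' p p' y y'
  have ha : 0 ≤ a := (norm_nonneg A).trans hA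
  have hκ : 0 ≤ κ := (norm_nonneg L).trans hL
  have hadj : ‖ContinuousLinearMap.adjoint A‖ ≤ a := by
    rwa [LinearIsometryEquiv.norm_map]
  have hX : ‖(F u + ContinuousLinearMap.adjoint A y)
      - (F u' + ContinuousLinearMap.adjoint A y')‖ ≤ ℓ * ‖u - u'‖ + a * ‖y - y'‖ := by
    rw [add_sub_add_comm, ← map_sub]
    exact norm_add_le_of_le (hF u u') (ContinuousLinearMap.le_of_opNorm_le _ hadj _)
  have hY : ‖L y - L y'‖ ≤ κ * ‖y - y'‖ := by
    rw [← map_sub]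
    exact L.le_of_opNorm_le hL _
  have hZ : ‖(bbar + L (y - p) - A u) - (bbar + L (y' - p') - A u')‖
      ≤ κ * (‖y - y'‖ + ‖p - p'‖) + a * ‖u - u'‖ := by
    have hsplit : (bbar + L (y - p) - A u) - (bbar + L (y' - p') - A u')
        = L ((y - y') - (p - p')) - A (u - u') := by
      simp only [map_sub]
      abel
    rw [hsplit]
    refine norm_sub_le_of_le ((L.le_of_opNorm_le hL _).trans ?_) (A.le_of_opNorm_le hA _)
    gcongr
    exact norm_sub_le _ _
  rw [Real.sqrt_le_iff, mul_pow, Real.sq_sqrt (by positivity)]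
  exact ⟨by positivity, sq_add_sq_add_sq_le_of_block_bounds hℓ ha hκ
    (norm_nonneg _) (norm_nonneg _) (norm_nonneg _) hX hY hZ⟩
end

section
/- Let F : ℝ^d → ℝ^d be monotone (⟨F(u) − F(u'), u − u'⟩ ≥ 0 for all u, u'), let A : ℝ^d → ℝ^{mN} be a continuous linear map, let L : ℝ^{mN} → ℝ^{mN} be a continuous linear self-adjoint positive-semidefinite map, and let b̄ ∈ ℝ^{mN}. Then the extended operator V on ℝ^d × ℝ^{mN} × ℝ^{mN} defined by V(u,p,y) = (F(u) + A*(y), L(y), b̄ + L(y − p) − A(u)) is monotone: ⟨V(x) − V(x'), x − x'⟩ ≥ 0 for all x, x' in the product space. -/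
open RealInnerProductSpace

/-- The extended operator `V(u,p,y) = (F(u) + A*(y), L(y), b̄ + L(y − p) − A(u))`
of the distributed splitting scheme is monotone on the product space
`ℝ^d × ℝ^{mN} × ℝ^{mN}` with the Euclidean product inner product, whenever the
pseudogradient `F` is monotone and `L` is self-adjoint and positive semidefinite. -/
theorem extended_operator_monotone {d mN : ℕ}
    (F : EuclideanSpace ℝ (Fin d) → EuclideanSpace ℝ (Fin d))
    (hF : ∀ u u', 0 ≤ ⟪F u - F u', u - u'⟫)
    (A : EuclideanSpace ℝ (Fin d) →L[ℝ] EuclideanSpace ℝ (Fin mN))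
    (L : EuclideanSpace ℝ (Fin mN) →L[ℝ] EuclideanSpace ℝ (Fin mN))
    (hLsa : ∀ x y, ⟪L x, y⟫ = ⟪x, L y⟫)
    (hLpsd : ∀ x, 0 ≤ ⟪L x, x⟫)
    (bbar : EuclideanSpace ℝ (Fin mN)) :
    ∀ (u u' : EuclideanSpace ℝ (Fin d)) (p p' y y' : EuclideanSpace ℝ (Fin mN)),
      0 ≤ ⟪(F u + ContinuousLinearMap.adjoint A y)
            - (F u' + ContinuousLinearMap.adjoint A y'), u - u'⟫
          + ⟪L y - L y', p - p'⟫
          + ⟪(bbar + L (y - p) - A u) - (bbar + L (y' - p') - A u'), y - y'⟫ := by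
  intro u u' p p' y y'
  have hFu := hF u u'
  have hLy := hLpsd (y - y')
  have hAdj : ⟪ContinuousLinearMap.adjoint A (y - y'), u - u'⟫ = ⟪A (u - u'), y - y'⟫ := by
    rw [ContinuousLinearMap.adjoint_inner_left, real_inner_comm]
  have hSymm : ⟪L (p - p'), y - y'⟫ = ⟪L (y - y'), p - p'⟫ := by
    rw [hLsa, real_inner_comm]
  have hu : (F u + ContinuousLinearMap.adjoint A y) - (F u' + ContinuousLinearMap.adjoint A y')
      = (F u - F u') + ContinuousLinearMap.adjoint A (y - y') := by
    rw [map_sub]; abel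
  have hy : (bbar + L (y - p) - A u) - (bbar + L (y' - p') - A u')
      = L (y - y') - L (p - p') - A (u - u') := by
    simp only [map_sub]; abel
  rw [hu, hy, ← map_sub L y y', inner_add_left, inner_sub_left _ (A (u - u')),
    inner_sub_left (L (y - y'))]
  linarith
end

section
/- (Robbins–Siegmund) Let (Ω, ℱ, ℙ) be a probability space with a filtration (ℱ_t)_{t∈ℕ}, and let (v_t)_{t∈ℕ} be a sequence of nonnegative integrable random variables such that v_t is ℱ_t-measurable for every t. Let (u_t) and (β_t) be deterministic sequences with 0 ≤ u_t ≤ 1 and β_t ≥ 0, and suppose that for every t, 𝔼[v_{t+1} ∣ ℱ_t] ≤ (1 − u_t) v_t + β_t almost surely. If Σ_{t=0}^∞ u_t = ∞, Σ_{t=0}^∞ β_t < ∞, and β_t / u_t → 0 as t → ∞, then v_t → 0 almost surely. -/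
open MeasureTheory Filter

/-- A nonnegative adapted process with `𝔼[w (t+1) ∣ ℱ t] ≤ w t + β t` and `Σ β t < ∞` converges
almost surely. -/
theorem ae_exists_tendsto_of_condExp_le_add
    {Ω : Type*} {m : MeasurableSpace Ω} {μ : Measure Ω} [IsFiniteMeasure μ]
    (ℱ : Filtration ℕ m) {w : ℕ → Ω → ℝ} {β : ℕ → ℝ}
    (hw_nonneg : ∀ t ω, 0 ≤ w t ω)
    (hw_int : ∀ t, Integrable (w t) μ)
    (hw_adapted : ∀ t, StronglyMeasurable[ℱ t] (w t))
    (hβ_nonneg : ∀ t, 0 ≤ β t)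
    (hβ_sum : Summable β)
    (hrec : ∀ t, ∀ᵐ ω ∂μ, (μ[w (t + 1) | ℱ t]) ω ≤ w t ω + β t) :
    ∀ᵐ ω ∂μ, ∃ l, Tendsto (fun t => w t ω) atTop (nhds l) := by
  set b : ℕ → ℝ := fun t => ∑ s ∈ Finset.range t, β s with hb
  have hb_nonneg : ∀ t, 0 ≤ b t := fun t => Finset.sum_nonneg fun s _ => hβ_nonneg s
  have hb_le : ∀ t, b t ≤ ∑' s, β s := fun t => hβ_sum.sum_le_tsum _ fun s _ => hβ_nonneg s
  have hsub : Submartingale (fun t ω => b t - w t ω) ℱ μ := by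
    refine submartingale_nat (fun t => stronglyMeasurable_const.sub (hw_adapted t))
      (fun t => (integrable_const _).sub (hw_int t)) fun t => ?_
    have h := condExp_sub (integrable_const (b (t + 1))) (hw_int (t + 1)) (ℱ t) (μ := μ)
    rw [condExp_const (ℱ.le t)] at h
    filter_upwards [h, hrec t] with ω h₁ h₂
    change b t - w t ω ≤ (μ[(fun _ => b (t + 1)) - w (t + 1) | ℱ t]) ω
    rw [h₁, Pi.sub_apply, hb]
    simp only [Finset.sum_range_succ]
    linarith
  have hmean : ∀ t, ∫ ω, w t ω ∂μ ≤ ∫ ω, w 0 ω ∂μ + μ.real Set.univ * b t := by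
    intro t
    have h := hsub.setIntegral_le (Nat.zero_le t) MeasurableSet.univ
    simp only [Measure.restrict_univ] at h
    rw [integral_sub (integrable_const _) (hw_int 0),
      integral_sub (integrable_const _) (hw_int t)] at h
    simp only [integral_const, smul_eq_mul, hb, Finset.range_zero, Finset.sum_empty,
      mul_zero] at h
    linarith
  have hbdd : ∀ t, eLpNorm (fun ω => b t - w t ω) 1 μ ≤
      (Real.toNNReal (∫ ω, w 0 ω ∂μ + 2 * (μ.real Set.univ * ∑' s, β s)) : ENNReal) := by
    intro t
    have hint : Integrable (fun ω => b t - w t ω) μ := (integrable_const _).sub (hw_int t)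
    rw [eLpNorm_one_eq_lintegral_enorm, ← ofReal_integral_norm_eq_lintegral_enorm hint]
    refine ENNReal.ofReal_le_ofReal ?_
    have h : ∫ ω, ‖b t - w t ω‖ ∂μ ≤ ∫ ω, (b t + w t ω) ∂μ := by
      refine integral_mono hint.norm ((integrable_const _).add (hw_int t)) fun ω => ?_
      have h₁ := hb_nonneg t
      have h₂ := hw_nonneg t ω
      exact abs_le.2 ⟨by linarith, by linarith⟩
    rw [integral_add (integrable_const _) (hw_int t), integral_const, smul_eq_mul] at h
    have h' := mul_le_mul_of_nonneg_left (hb_le t) (measureReal_nonneg (μ := μ) (s := Set.univ))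
    linarith [hmean t]
  filter_upwards [hsub.exists_ae_tendsto_of_bdd hbdd] with ω ⟨c, hc⟩
  refine ⟨_, (hβ_sum.hasSum.tendsto_sum_nat.sub hc).congr fun t => ?_⟩
  simp [hb]

/-- Robbins–Siegmund lemma (deterministic-coefficients version): if nonnegative
adapted integrable random variables `v t` satisfy
`𝔼[v (t+1) ∣ ℱ t] ≤ (1 − u t) v t + β t` a.s. with `0 ≤ u t ≤ 1`, `β t ≥ 0`,
`Σ u t = ∞`, `Σ β t < ∞` and `β t / u t → 0`, then `v t → 0` almost surely. -/
theorem robbins_siegmund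
    {Ω : Type*} {m : MeasurableSpace Ω} {μ : Measure Ω} [IsProbabilityMeasure μ]
    (ℱ : Filtration ℕ m)
    (v : ℕ → Ω → ℝ)
    (hv_nonneg : ∀ t ω, 0 ≤ v t ω)
    (hv_int : ∀ t, Integrable (v t) μ)
    (hv_adapted : ∀ t, StronglyMeasurable[ℱ t] (v t))
    (u β : ℕ → ℝ)
    (hu_nonneg : ∀ t, 0 ≤ u t) (hu_le_one : ∀ t, u t ≤ 1)
    (hβ_nonneg : ∀ t, 0 ≤ β t)
    (hrec : ∀ t, ∀ᵐ ω ∂μ, (μ[v (t + 1) | ℱ t]) ω ≤ (1 - u t) * v t ω + β t)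
    (hu_div : ¬ Summable u)
    (hβ_sum : Summable β)
    (hratio : Tendsto (fun t => β t / u t) atTop (nhds 0)) :
    ∀ᵐ ω ∂μ, Tendsto (fun t => v t ω) atTop (nhds 0) := by
  set S : ℕ → Ω → ℝ := fun t ω => ∑ s ∈ Finset.range t, u s * v s ω with hS
  have hS_nonneg : ∀ t ω, 0 ≤ S t ω := fun t ω =>
    Finset.sum_nonneg fun s _ => mul_nonneg (hu_nonneg s) (hv_nonneg s ω)
  have hS_int : ∀ t, Integrable (S t) μ := fun t =>
    integrable_finsetSum _ fun s _ => (hv_int s).const_mul (u s)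
  have hS_meas : ∀ t, StronglyMeasurable[ℱ t] (S (t + 1)) := fun t =>
    Finset.stronglyMeasurable_fun_sum _ fun s hs =>
      ((hv_adapted s).mono (ℱ.mono (Finset.mem_range_succ_iff.1 hs))).const_mul (u s)
  have hS_adapted : ∀ t, StronglyMeasurable[ℱ t] (S t) := fun t =>
    Finset.stronglyMeasurable_fun_sum _ fun s hs =>
      ((hv_adapted s).mono (ℱ.mono (Finset.mem_range.1 hs).le)).const_mul (u s)
  have hv_lim := ae_exists_tendsto_of_condExp_le_add ℱ hv_nonneg hv_int hv_adapted hβ_nonneg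
    hβ_sum fun t => by
      filter_upwards [hrec t] with ω h
      nlinarith [mul_nonneg (hu_nonneg t) (hv_nonneg t ω)]
  have hvS_lim := ae_exists_tendsto_of_condExp_le_add ℱ (w := fun t => v t + S t)
    (fun t ω => add_nonneg (hv_nonneg t ω) (hS_nonneg t ω))
    (fun t => (hv_int t).add (hS_int t)) (fun t => (hv_adapted t).add (hS_adapted t)) hβ_nonneg
    hβ_sum fun t => by
      have h := condExp_add (hv_int (t + 1)) (hS_int (t + 1)) (ℱ t)
      rw [condExp_of_stronglyMeasurable (ℱ.le t) (hS_meas t) (hS_int (t + 1))] at h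
      filter_upwards [hrec t, h] with ω h₁ h₂
      rw [h₂, Pi.add_apply, Pi.add_apply]
      simp only [hS, Finset.sum_range_succ]
      linarith
  filter_upwards [hv_lim, hvS_lim] with ω ⟨l, hl⟩ ⟨c, hc⟩
  have hl_nonneg : 0 ≤ l := ge_of_tendsto' hl fun t => hv_nonneg t ω
  have hS_lim : Tendsto (fun t => S t ω) atTop (nhds (c - l)) :=
    (hc.sub hl).congr fun t => by simp
  have huv : Summable fun t => u t * v t ω :=
    ((hasSum_iff_tendsto_nat_of_nonneg
      (fun t => mul_nonneg (hu_nonneg t) (hv_nonneg t ω)) _).2 hS_lim).summable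
  rcases hl_nonneg.eq_or_lt with rfl | hl_pos
  · exact hl
  · refine absurd ?_ hu_div
    obtain ⟨N, hN⟩ := eventually_atTop.1 (hl.eventually (lt_mem_nhds (half_lt_self hl_pos)))
    rw [← summable_nat_add_iff N]
    refine Summable.of_nonneg_of_le (fun t => hu_nonneg _) (fun t => ?_)
      (((summable_nat_add_iff N).2 huv).mul_left (2 / l))
    have h := mul_le_mul_of_nonneg_left (hN (t + N) (Nat.le_add_left N t)).le
      (hu_nonneg (t + N))
    calc u (t + N) = 2 / l * (u (t + N) * (l / 2)) := by field_simp
      _ ≤ 2 / l * (u (t + N) * v (t + N) ω) := by gcongr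
end

section
/- Let E be a real inner product space and Φ : E → E a continuous linear self-adjoint bijection with self-adjoint inverse Φ⁻¹; write ‖w‖²_Φ := ⟨Φ w, w⟩ and ‖w‖²_{Φ⁻¹} := ⟨Φ⁻¹ w, w⟩. Let z_k, z_half, z_next, x* ∈ E and v_half, w, g ∈ E satisfy Φ(z_k − z_half) = v_half + w and z_next = z_half − Φ⁻¹(g). Then ‖z_next − x*‖²_Φ = ‖z_k − x*‖²_Φ − ‖z_k − z_half‖²_Φ + ‖g‖²_{Φ⁻¹} − 2⟨v_half + w + g, z_half − x*⟩. -/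
open RealInnerProductSpace

/-- One-step energy identity of the forward-backward-forward splitting step.
With `Φ` a self-adjoint continuous linear bijection with self-adjoint inverse `Ψ`,
`Φ(z_k − z_half) = v_half + w` and `z_next = z_half − Φ⁻¹ g`, one has
`‖z_next − x*‖²_Φ = ‖z_k − x*‖²_Φ − ‖z_k − z_half‖²_Φ + ‖g‖²_{Φ⁻¹}
  − 2⟨v_half + w + g, z_half − x*⟩`, where `‖w‖²_Φ = ⟨Φ w, w⟩` and
`‖w‖²_{Φ⁻¹} = ⟨Φ⁻¹ w, w⟩`. -/
theorem fbf_energy_identity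
    {E : Type*} [NormedAddCommGroup E] [InnerProductSpace ℝ E]
    (Φ Ψ : E →L[ℝ] E)
    (hΦsa : ∀ x y, ⟪Φ x, y⟫ = ⟪x, Φ y⟫)
    (hΨsa : ∀ x y, ⟪Ψ x, y⟫ = ⟪x, Ψ y⟫)
    (hΨΦ : ∀ x, Ψ (Φ x) = x) (hΦΨ : ∀ x, Φ (Ψ x) = x)
    (z_k z_half z_next xs v_half w g : E)
    (hhalf : Φ (z_k - z_half) = v_half + w)
    (hnext : z_next = z_half - Ψ g) :
    ⟪Φ (z_next - xs), z_next - xs⟫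
      = ⟪Φ (z_k - xs), z_k - xs⟫ - ⟪Φ (z_k - z_half), z_k - z_half⟫
        + ⟪Ψ g, g⟫ - 2 * ⟪v_half + w + g, z_half - xs⟫ := by
  have hk : z_k - xs = (z_k - z_half) + (z_half - xs) := by abel
  have hn : z_next - xs = (z_half - xs) - Ψ g := by rw [hnext]; abel
  rw [hk, hn, ← hhalf]
  generalize z_k - z_half = d
  generalize z_half - xs = a
  have hag : ⟪Φ a, Ψ g⟫ = ⟪g, a⟫ := by rw [hΦsa, hΦΨ, real_inner_comm]
  have had : ⟪Φ a, d⟫ = ⟪Φ d, a⟫ := by rw [hΦsa, real_inner_comm]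
  simp only [map_add, map_sub, hΦΨ, inner_add_left, inner_add_right, inner_sub_left,
    inner_sub_right, hag, had, real_inner_comm g (Ψ g)]
  ring
end

section
/- Let E be a real inner product space and Φ : E → E a continuous linear self-adjoint positive-definite bijection with self-adjoint inverse Φ⁻¹; write ‖w‖²_Φ := ⟨Φ w, w⟩ and ‖w‖²_{Φ⁻¹} := ⟨Φ⁻¹ w, w⟩. Let H : E → ℝ be convex, let V : E → E be monotone (⟨V(x) − V(y), x − y⟩ ≥ 0 for all x, y), let G̃ : E → E be any map, and set ε := G̃ − V. Let z_k, x_t, x, W̄ ∈ E, let z_half ∈ E satisfy the subgradient condition H(y) ≥ H(z_half) + ⟨Φ(z_k − z_half) − (V(x_t) − W̄), y − z_half⟩ for all y ∈ E, and set z_next := z_half − Φ⁻¹(G̃(z_half) − G̃(x_t)). Define Q(x, z) := ⟨V(x), z − x⟩ + H(z) − H(x). Then 2 Q(x, z_half) ≤ ‖z_k − x‖²_Φ − ‖z_next − x‖²_Φ − ‖z_half − z_k‖²_Φ + ‖G̃(z_half) − G̃(x_t)‖²_{Φ⁻¹} + 2⟨W̄, z_half − x⟩ − 2⟨ε(z_half)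 − ε(x_t), z_half − x⟩. -/
open RealInnerProductSpace

/-- Per-step restricted-merit (gap) inequality in the merely monotone analysis
of the variance-reduced FBF scheme. With `Φ` self-adjoint positive definite with
self-adjoint inverse `Ψ`, `H` convex, `V` monotone, sampling error
`ε = G̃ − V`, the resolvent half-step encoded by the subgradient inequality and
the correction step `z_next = z_half − Φ⁻¹(G̃(z_half) − G̃(x_t))`, one has, for
`Q(x,z) = ⟨V(x), z − x⟩ + H(z) − H(x)`,
`2 Q(x, z_half) ≤ ‖z_k − x‖²_Φ − ‖z_next − x‖²_Φ − ‖z_half − z_k‖²_Φ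
  + ‖G̃(z_half) − G̃(x_t)‖²_{Φ⁻¹} + 2⟨W̄, z_half − x⟩
  − 2⟨ε(z_half) − ε(x_t), z_half − x⟩`. -/
theorem per_step_gap_inequality
    {E : Type*} [NormedAddCommGroup E] [InnerProductSpace ℝ E]
    (Φ Ψ : E →L[ℝ] E)
    (hΦsa : ∀ x y, ⟪Φ x, y⟫ = ⟪x, Φ y⟫)
    (hΨsa : ∀ x y, ⟪Ψ x, y⟫ = ⟪x, Ψ y⟫)
    (hΦpd : ∀ w : E, w ≠ 0 → 0 < ⟪Φ w, w⟫)
    (hΨΦ : ∀ x, Ψ (Φ x) = x) (hΦΨ : ∀ x, Φ (Ψ x) = x)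
    (H : E → ℝ) (hH : ConvexOn ℝ Set.univ H)
    (V : E → E) (hV : ∀ x y, 0 ≤ ⟪V x - V y, x - y⟫)
    (G : E → E) (ε : E → E) (hε : ∀ w, ε w = G w - V w)
    (z_k x_t x W z_half z_next : E)
    (hsub : ∀ y, H z_half + ⟪Φ (z_k - z_half) - (V x_t - W), y - z_half⟫ ≤ H y)
    (hnext : z_next = z_half - Ψ (G z_half - G x_t))
    (Q : E → E → ℝ) (hQ : ∀ a b, Q a b = ⟪V a, b - a⟫ + H b - H a) :
    2 * Q x z_half
      ≤ ⟪Φ (z_k - x), z_k - x⟫ - ⟪Φ (z_next - x), z_next - x⟫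
        - ⟪Φ (z_half - z_k), z_half - z_k⟫
        + ⟪Ψ (G z_half - G x_t), G z_half - G x_t⟫
        + 2 * ⟪W, z_half - x⟫
        - 2 * ⟪ε z_half - ε x_t, z_half - x⟫ := by
  obtain ⟨p, hp⟩ : ∃ p, p = z_half - x := ⟨_, rfl⟩
  obtain ⟨q, hq⟩ : ∃ q, q = z_k - z_half := ⟨_, rfl⟩
  obtain ⟨d, hd⟩ : ∃ d, d = G z_half - G x_t := ⟨_, rfl⟩
  have hres := hsub x
  have hmono := hV z_half x
  have hεd : ε z_half - ε x_t = d - (V z_half - V x_t) := by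
    rw [hε, hε, hd]; abel
  have hzk : z_k - x = q + p := by rw [hp, hq]; abel
  have hzn : z_next - x = p - Ψ d := by rw [hnext, hp, hd]; abel
  have hback : z_half - z_k = -q := by rw [hq]; abel
  have hxp : x - z_half = -p := by rw [hp]; abel
  have hqp : ⟪Φ p, q⟫ = ⟪Φ q, p⟫ := by rw [hΦsa, real_inner_comm]
  have hpd : ⟪Φ p, Ψ d⟫ = ⟪d, p⟫ := by rw [hΦsa, hΦΨ, real_inner_comm]
  have hdd : ⟪d, Ψ d⟫ = ⟪Ψ d, d⟫ := real_inner_comm _ _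
  rw [hxp, ← hq] at hres
  rw [← hp] at hmono
  rw [hQ, hεd, hzk, hzn, hback, ← hp, ← hd]
  simp only [map_add, map_sub, map_neg, hΦΨ, inner_add_left, inner_add_right, inner_sub_left,
    inner_sub_right, inner_neg_left, inner_neg_right, hqp, hpd, hdd] at hres hmono ⊢
  linarith
end
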